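/- arXiv:1708.00833 — 2 statements merged into one kernel-verified Lean document; each statement's English description precedes it below -/
import Mathlib

section
/- Let A be a semisimple quasi-abelian category. Then every morphism f : a → b in A factors as f = f_m ∘ f_em ∘ f_e, where f_e : a → coim(f) is the projection onto a direct summand of a (in particular a split strict epimorphism), f_em : coim(f) → im(f) is both an epimorphism and a monomorphism, and f_m : im(f) → b is the inclusion of a direct summand of b (in particular a split strict monomorphism). -/
open CategoryTheory Limits

noncomputable section

universe v u

variable {C : Type u} [Category.{v} C] [Preadditive C] [HasKernels C] [HasCokernels C]
  [HasPullbacks C] [HasPushouts C]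

/-- A morphism is strict if the canonical morphism `coim(f) → im(f)` is an
isomorphism. -/
def IsStrictMor {X Y : C} (f : X ⟶ Y) : Prop := IsIso (Abelian.coimageImageComparison f)

/-- Quasi-abelian: pullbacks of strict epimorphisms are strict epimorphisms, and
pushouts of strict monomorphisms are strict monomorphisms. -/
def IsQuasiAbelian (C : Type u) [Category.{v} C] [Preadditive C] [HasKernels C]
    [HasCokernels C] [HasPullbacks C] [HasPushouts C] : Prop :=
  (∀ {X Y Z : C} (f : X ⟶ Y) (g : Z ⟶ Y), IsStrictMor f → Epi f →
    (IsStrictMor (pullback.snd f g) ∧ Epi (pullback.snd f g))) ∧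
  (∀ {X Y Z : C} (f : X ⟶ Y) (g : X ⟶ Z), IsStrictMor f → Mono f →
    (IsStrictMor (pushout.inr f g) ∧ Mono (pushout.inr f g)))

/-- A short strictly exact sequence: `f` is a kernel of `g` and `g` is a strict
epimorphism. -/
def ShortStrictExact {X Y Z : C} (f : X ⟶ Y) (g : Y ⟶ Z) : Prop :=
  IsStrictMor g ∧ Epi g ∧ ∃ w : f ≫ g = 0, Nonempty (IsLimit (KernelFork.ofι f w))

/-- Semisimplicity: every short strictly exact sequence splits. -/
def IsSemisimpleQA (C : Type u) [Category.{v} C] [Preadditive C] [HasKernels C]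
    [HasCokernels C] [HasPullbacks C] [HasPushouts C] : Prop :=
  ∀ {X Y Z : C} (f : X ⟶ Y) (g : Y ⟶ Z), ShortStrictExact f g →
    ∃ (r : Y ⟶ X) (s : Z ⟶ Y), f ≫ r = 𝟙 X ∧ s ≫ g = 𝟙 Z

/-- A cokernel is a strict morphism. -/
lemma isStrictMor_cokernel_π {X Y : C} (h : X ⟶ Y) : IsStrictMor (cokernel.π h) := by
  have hz : h ≫ Abelian.coimage.π (cokernel.π h) = 0 := by
    have hl := kernel.lift_ι (cokernel.π h) h (cokernel.condition h) =≫
      Abelian.coimage.π (cokernel.π h)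
    rw [← hl, Category.assoc]
    exact (congrArg _ (cokernel.condition (kernel.ι (cokernel.π h)))).trans comp_zero
  have he : cokernel.π h ≫ cokernel.desc h _ hz = Abelian.coimage.π (cokernel.π h) :=
    cokernel.π_desc _ _ _
  have hfac := Abelian.coimage_image_factorisation (cokernel.π h)
  refine ⟨Abelian.image.ι (cokernel.π h) ≫ cokernel.desc h _ hz, ?_, ?_⟩
  · rw [← cancel_epi (Abelian.coimage.π (cokernel.π h)), Category.comp_id, reassoc_of% hfac, he]
  · have hid : cokernel.desc h _ hz ≫ Abelian.coimageImageComparison (cokernel.π h) ≫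
        Abelian.image.ι (cokernel.π h) = 𝟙 _ := by
      rw [← cancel_epi (cokernel.π h), reassoc_of% he, hfac, Category.comp_id]
    rw [← cancel_mono (Abelian.image.ι (cokernel.π h))]
    simp only [Category.assoc, hid, Category.comp_id, Category.id_comp]

lemma shortStrictExact_image {X Y : C} (f : X ⟶ Y) :
    ShortStrictExact (Abelian.image.ι f) (cokernel.π f) :=
  ⟨isStrictMor_cokernel_π f, inferInstance, kernel.condition _, ⟨kernelIsKernel _⟩⟩

lemma shortStrictExact_coimage {X Y : C} (f : X ⟶ Y) :
    ShortStrictExact (kernel.ι f) (Abelian.coimage.π f) := by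
  refine ⟨isStrictMor_cokernel_π _, inferInstance, cokernel.condition _,
    ⟨KernelFork.IsLimit.ofι' _ _ fun {A} k hk => ⟨kernel.lift f k ?_, kernel.lift_ι _ _ _⟩⟩⟩
  rw [← Abelian.coimage_image_factorisation f, reassoc_of% hk, zero_comp]

/-- **Statement 13.** In a semisimple quasi-abelian category every morphism `f` factors
as `f = f_m ∘ f_em ∘ f_e` where `f_e : a → coim(f)` is a projection onto a direct
summand (split epimorphism), `f_em : coim(f) → im(f)` is an epimonomorphism, and
`f_m : im(f) → b` is the inclusion of a direct summand (split monomorphism). -/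
theorem factorization_in_semisimple_quasiAbelian
    (hqa : IsQuasiAbelian C) (hss : IsSemisimpleQA C) {X Y : C} (f : X ⟶ Y) :
    IsSplitEpi (Abelian.coimage.π f) ∧
    Epi (Abelian.coimageImageComparison f) ∧
    Mono (Abelian.coimageImageComparison f) ∧
    IsSplitMono (Abelian.image.ι f) ∧
    Abelian.coimage.π f ≫ Abelian.coimageImageComparison f ≫ Abelian.image.ι f = f := by
  obtain ⟨-, s, -, hs⟩ := hss _ _ (shortStrictExact_coimage f)
  obtain ⟨r, -, hr, -⟩ := hss _ _ (shortStrictExact_image f)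
  have hfac := Abelian.coimage_image_factorisation f
  refine ⟨⟨⟨s, hs⟩⟩, Preadditive.epi_of_cancel_zero _ fun g hg => ?_,
    Preadditive.mono_of_cancel_zero _ fun g hg => ?_, ⟨⟨r, hr⟩⟩, hfac⟩
  · have hz : f ≫ r ≫ g = 0 := by
      rw [← reassoc_of% hfac, reassoc_of% hr, hg, comp_zero]
    rw [← Category.id_comp g, ← hr, Category.assoc, ← cokernel.π_desc f _ hz,
      ← Category.assoc]
    exact (congrArg (· ≫ _) (kernel.condition _)).trans zero_comp
  · have hz : (g ≫ s) ≫ f = 0 := by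
      have hsf := s ≫= hfac
      rw [reassoc_of% hs] at hsf
      rw [Category.assoc, ← hsf, reassoc_of% hg, zero_comp]
    rw [← Category.comp_id g, ← hs, ← Category.assoc, ← kernel.lift_ι f _ hz,
      Category.assoc]
    exact (congrArg _ (cokernel.condition _)).trans comp_zero

end
end

section
/- Let S and T be spectral spaces and let p, g : S → T be spectral maps such that: p and g are homeomorphisms onto their images; the images of p and g are disjoint and their union is all of T; the image of p is open in T; there exists a spectral map r : T → S with r∘p = id_S = r∘g; and g(x) lies in the closure of {p(x)} for every x ∈ S. Then the assignments (Π ⊆ Γ) ↦ p(Π) ∪ g(Γ) and Y ↦ (p^{−1}(Y) ⊆ g^{−1}(Y)) are mutually inverse, inclusion-preserving bijections between the set of pairs Π ⊆ Γ of Thomason subsets of S and the set of Thomason subsets of T. -/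
open Set

/-- A spectral space: quasi-compact, sober, whose quasi-compact open subsets are closed
under finite intersections and form a basis of the topology. -/
structure IsSpectralSpace (X : Type) [TopologicalSpace X] : Prop where
  compact : CompactSpace X
  t0 : T0Space X
  sober : QuasiSober X
  qc_inter : ∀ U V : Set X, IsOpen U → IsCompact U → IsOpen V → IsCompact V →
    IsCompact (U ∩ V)
  qc_basis : ∀ (U : Set X) (x : X), IsOpen U → x ∈ U →
    ∃ V : Set X, IsOpen V ∧ IsCompact V ∧ x ∈ V ∧ V ⊆ U

/-- Thomason subsets: unions of closed subsets each of whose complement is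
quasi-compact open. -/
def IsThomason {X : Type} [TopologicalSpace X] (Y : Set X) : Prop :=
  ∃ S : Set (Set X), (∀ s ∈ S, IsClosed s ∧ IsCompact sᶜ) ∧ Y = ⋃₀ S

namespace IsThomason

variable {X Y : Type} [TopologicalSpace X] [TopologicalSpace Y]

theorem union {A B : Set X} (hA : IsThomason A) (hB : IsThomason B) : IsThomason (A ∪ B) := by
  obtain ⟨F, hF, rfl⟩ := hA
  obtain ⟨F', hF', rfl⟩ := hB
  exact ⟨F ∪ F', fun s hs => hs.elim (hF s) (hF' s), (sUnion_union F F').symm⟩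

theorem preimage {f : X → Y} (hf : IsSpectralMap f) {A : Set Y} (hA : IsThomason A) :
    IsThomason (f ⁻¹' A) := by
  obtain ⟨F, hF, rfl⟩ := hA
  refine ⟨(f ⁻¹' ·) '' F, ?_, by rw [preimage_sUnion, sUnion_image]⟩
  rintro _ ⟨s, hs, rfl⟩
  obtain ⟨hcl, hco⟩ := hF s hs
  exact ⟨hcl.preimage hf.continuous, hf.isCompact_preimage_of_isOpen hcl.isOpen_compl hco⟩

theorem inter_isClosed {A C : Set X} (hA : IsThomason A) (hC : IsClosed C)
    (hC' : IsCompact Cᶜ) : IsThomason (A ∩ C) := by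
  obtain ⟨F, hF, rfl⟩ := hA
  refine ⟨(· ∩ C) '' F, ?_, by rw [sUnion_image, sUnion_eq_biUnion, iUnion₂_inter]⟩
  rintro _ ⟨s, hs, rfl⟩
  obtain ⟨hcl, hco⟩ := hF s hs
  exact ⟨hcl.inter hC, by simpa only [compl_inter] using hco.union hC'⟩

theorem mem_of_specializes {A : Set X} (hA : IsThomason A) {x y : X} (h : x ⤳ y)
    (hx : x ∈ A) : y ∈ A := by
  obtain ⟨F, hF, rfl⟩ := hA
  obtain ⟨s, hs, hxs⟩ := hx
  exact ⟨s, hs, h.mem_closed (hF s hs).1 hxs⟩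

end IsThomason

/-- **Statement 18.** Let `S`, `T` be spectral spaces and `p, g : S → T` spectral maps
which are homeomorphisms onto their images, with disjoint images jointly covering `T`,
`im(p)` open, admitting a common spectral retraction `r`, and such that `g x` is a
specialization of `p x` for every `x`.  Then `(Π ⊆ Γ) ↦ p(Π) ∪ g(Γ)` and
`Y ↦ (p⁻¹ Y ⊆ g⁻¹ Y)` are mutually inverse, inclusion-preserving bijections between
pairs of Thomason subsets `Π ⊆ Γ` of `S` and Thomason subsets of `T`. -/
theorem thomason_pairs_bijection
    (S T : Type) [TopologicalSpace S] [TopologicalSpace T]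
    (hS : IsSpectralSpace S) (hT : IsSpectralSpace T)
    (p g : S → T) (hp : IsSpectralMap p) (hg : IsSpectralMap g)
    (hpe : Topology.IsEmbedding p) (hge : Topology.IsEmbedding g)
    (hdisj : ∀ x y : S, p x ≠ g y)
    (hcover : Set.range p ∪ Set.range g = Set.univ)
    (hopen : IsOpen (Set.range p))
    (r : T → S) (hr : IsSpectralMap r) (hrp : r ∘ p = id) (hrg : r ∘ g = id)
    (hsp : ∀ x : S, g x ∈ closure {p x}) :
    (∀ P G : Set S, IsThomason P → IsThomason G → P ⊆ G →
      IsThomason (p '' P ∪ g '' G)) ∧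
    (∀ Y : Set T, IsThomason Y →
      IsThomason (p ⁻¹' Y) ∧ IsThomason (g ⁻¹' Y) ∧ p ⁻¹' Y ⊆ g ⁻¹' Y) ∧
    (∀ P G : Set S, IsThomason P → IsThomason G → P ⊆ G →
      p ⁻¹' (p '' P ∪ g '' G) = P ∧ g ⁻¹' (p '' P ∪ g '' G) = G) ∧
    (∀ Y : Set T, IsThomason Y → p '' (p ⁻¹' Y) ∪ g '' (g ⁻¹' Y) = Y) ∧
    (∀ P G P' G' : Set S, P ⊆ P' → G ⊆ G' → p '' P ∪ g '' G ⊆ p '' P' ∪ g '' G') := by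
  have hrp' : ∀ x, r (p x) = x := congrFun hrp
  have hrg' : ∀ x, r (g x) = x := congrFun hrg
  have hcompl : (range g)ᶜ = range p := by
    refine (IsCompl.of_eq ?_ hcover).symm.compl_eq
    exact (disjoint_range_iff.2 hdisj).eq_bot
  have hcases : ∀ t, t ∈ range p ∪ range g := fun t => hcover ▸ mem_univ t
  refine ⟨fun P G hP hG hPG => ?_, fun Y hY => ⟨hY.preimage hp, hY.preimage hg, fun x hx => ?_⟩,
    fun P G _ _ _ => ⟨?_, ?_⟩, fun Y _ => ?_, fun P G P' G' hP hG => ?_⟩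
  · have heq : p '' P ∪ g '' G = r ⁻¹' P ∪ r ⁻¹' G ∩ range g := by
      ext t
      rcases hcases t with ⟨x, rfl⟩ | ⟨x, rfl⟩
      · simp [hrp', hpe.injective.eq_iff, (hdisj _ _).symm]
      · simpa [hrg', hge.injective.eq_iff, hdisj] using fun h => hPG h
    have := hS.compact
    rw [heq]
    refine (hP.preimage hr).union ((hG.preimage hr).inter_isClosed ?_ ?_)
    · rwa [← isOpen_compl_iff, hcompl]
    · rw [hcompl]
      exact isCompact_range hp.continuous
  · exact hY.mem_of_specializes (specializes_iff_mem_closure.2 (hsp x)) hx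
  · ext x
    simp [hpe.injective.eq_iff, (hdisj _ _).symm]
  · ext x
    simp [hge.injective.eq_iff, hdisj]
  · rw [image_preimage_eq_inter_range, image_preimage_eq_inter_range, ← inter_union_distrib_left,
      hcover, inter_univ]
  · exact union_subset_union (image_mono hP) (image_mono hG)
end
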